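/- Fix a ∈ ℍ and an integer n ≥ 0, and define ξ : ℍ → ℂ by ξ(z) = ∫₀^{Im z} (−i)·ζ²·(z − conj(a) − 2iζ)ⁿ dζ (the integrand equals −i·ζ²·conj(f(conj(z) + 2iζ)) for f(w) = (w − a)ⁿ). Then for every z ∈ ℍ, ∂ξ/∂z̄(z) = ((Im z)²/2)·conj((z − a)ⁿ); that is, ξ is an explicit harmonic vector field whose associated holomorphic quadratic differential is q = (z − a)ⁿ dz². -/

import Mathlib

/-- The Wirtinger derivative `∂f/∂z̄` of a function `f : ℂ → ℂ` at `z`. -/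
noncomputable def wirtingerDbar (f : ℂ → ℂ) (z : ℂ) : ℂ :=
  (1 / 2 : ℂ) * (fderiv ℝ f z 1 + Complex.I * fderiv ℝ f z Complex.I)

open Complex in
/-- The real derivative of the product of a holomorphic function with a function of `Im`. -/
theorem hasFDerivAt_mul_comp_im {p : ℂ → ℂ} {P : ℝ → ℂ} {p' P' z : ℂ}
    (hp : HasDerivAt p p' z) (hP : HasDerivAt P P' z.im) :
    HasFDerivAt (fun w : ℂ => p w * P w.im)
      (p z • imCLM.smulRight P' +
        P z.im • (ContinuousLinearMap.toSpanSingleton ℂ p').restrictScalars ℝ) z := by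
  have hPim : HasFDerivAt (fun w : ℂ => P w.im) (imCLM.smulRight P') z := by
    refine HasFDerivAt.congr_fderiv
      (HasFDerivAt.comp (g := P) z hP.hasFDerivAt imCLM.hasFDerivAt) ?_
    ext v
    simp
  exact (hp.hasFDerivAt.restrictScalars ℝ).mul hPim

open Complex in
/-- Only the factor depending on `Im` contributes to `∂/∂z̄`. -/
theorem wirtingerDbar_mul_comp_im {p : ℂ → ℂ} {P : ℝ → ℂ} {p' P' z : ℂ}
    (hp : HasDerivAt p p' z) (hP : HasDerivAt P P' z.im) :
    wirtingerDbar (fun w : ℂ => p w * P w.im) z = I / 2 * (p z * P') := by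
  rw [wirtingerDbar, (hasFDerivAt_mul_comp_im hp hP).fderiv]
  simp
  linear_combination (1 / 2 * P z.im * p') * I_mul_I

theorem wirtingerDbar_finset_sum {ι : Type*} (s : Finset ι) {f : ι → ℂ → ℂ} {z : ℂ}
    (hf : ∀ i ∈ s, DifferentiableAt ℝ (f i) z) :
    wirtingerDbar (fun w => ∑ i ∈ s, f i w) z = ∑ i ∈ s, wirtingerDbar (f i) z := by
  simp only [wirtingerDbar, fderiv_fun_sum hf, sum_apply, Finset.mul_sum,
    ← Finset.sum_add_distrib]

/-- For fixed `a ∈ ℍ` and `n ≥ 0`, the explicit vector field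
`ξ(z) = ∫₀^{Im z} (−i)ζ²(z − conj(a) − 2iζ)ⁿ dζ` is a harmonic vector field on ℍ
whose associated holomorphic quadratic differential is `q = (z − a)ⁿ dz²`. -/
theorem statement6 (a : ℂ) (ha : 0 < a.im) (n : ℕ)
    (ξ : ℂ → ℂ)
    (hξ : ∀ z : ℂ, ξ z = ∫ ζ in (0:ℝ)..z.im,
        (-Complex.I) * (ζ : ℂ) ^ 2 *
          (z - (starRingEnd ℂ) a - 2 * Complex.I * (ζ : ℂ)) ^ n) :
    ∀ z : ℂ, 0 < z.im →
      wirtingerDbar ξ z = ((z.im ^ 2 / 2 : ℝ) : ℂ) * (starRingEnd ℂ) ((z - a) ^ n) := by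
  intro z _
  set g : ℕ → ℝ → ℂ := fun k ζ =>
    -Complex.I * (ζ : ℂ) ^ 2 * (-(2 * Complex.I * (ζ : ℂ))) ^ (n - k) * (n.choose k : ℂ) with hg
  have hg_cont : ∀ k, Continuous (g k) := fun k => by fun_prop
  have integrand_eq : ∀ (w : ℂ) (ζ : ℝ),
      -Complex.I * (ζ : ℂ) ^ 2 * (w - (starRingEnd ℂ) a - 2 * Complex.I * (ζ : ℂ)) ^ n =
        ∑ k ∈ Finset.range (n + 1), (w - (starRingEnd ℂ) a) ^ k * g k ζ := by
    intro w ζ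
    rw [sub_eq_add_neg _ (2 * Complex.I * (ζ : ℂ)), add_pow, Finset.mul_sum]
    refine Finset.sum_congr rfl fun k _ => ?_
    simp only [hg]
    ring
  have hξ_sum : ξ = fun w => ∑ k ∈ Finset.range (n + 1),
      (w - (starRingEnd ℂ) a) ^ k * ∫ ζ in (0 : ℝ)..w.im, g k ζ := by
    funext w
    simp only [hξ, integrand_eq]
    rw [intervalIntegral.integral_finsetSum fun k _ =>
      ((hg_cont k).const_mul _).intervalIntegrable _ _]
    simp only [intervalIntegral.integral_const_mul]
  have hpow : ∀ k : ℕ, HasDerivAt (fun w : ℂ => (w - (starRingEnd ℂ) a) ^ k)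
      (k * (z - (starRingEnd ℂ) a) ^ (k - 1)) z := fun k => by
    simpa using ((hasDerivAt_id z).sub_const ((starRingEnd ℂ) a)).fun_pow k
  have hint : ∀ k, HasDerivAt (fun t : ℝ => ∫ ζ in (0 : ℝ)..t, g k ζ) (g k z.im) z.im :=
    fun k => (hg_cont k).integral_hasStrictDerivAt 0 z.im |>.hasDerivAt
  have hconj : z - (starRingEnd ℂ) a - 2 * Complex.I * (z.im : ℂ) = (starRingEnd ℂ) (z - a) := by
    apply Complex.ext <;> simp
    ring
  rw [hξ_sum, wirtingerDbar_finset_sum _ fun k _ =>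
    (hasFDerivAt_mul_comp_im (hpow k) (hint k)).differentiableAt]
  simp only [fun k => wirtingerDbar_mul_comp_im (hpow k) (hint k)]
  rw [← Finset.mul_sum, ← integrand_eq, hconj, map_pow]
  push_cast
  linear_combination
    (-(z.im : ℂ) ^ 2 / 2 * (starRingEnd ℂ) (z - a) ^ n) * Complex.I_mul_I
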